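/- arXiv:2310.19314 — 4 statements merged into one kernel-verified Lean document; each statement's English description precedes it below -/
import Mathlib

section
/- Let A = (a_{ij})_{i,j∈ℕ} be an ℕ × ℕ binary matrix (a_{ij} ∈ {0,1}) and let α ∈ [0,1] be such that every row r^(i) = (a_{ij})_{j∈ℕ} has upper asymptotic density at most α. Consider the two-person win-lose game G = (ℕ, ℕ, π) with π(i,j) = a_{ij}. Then sup over mixed strategies p of player 1 of inf over mixed strategies q of player 2 of π^mix(p,q) is at most α. -/
open scoped ENNReal Classical

/-- The expected payoff to player 1 (probability that player 1 wins) when player 1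
uses mixed strategy `p` and player 2 uses mixed strategy `q`. -/
noncomputable def mixedPayoff {S T : Type*} (π : S → T → Prop) (p : PMF S) (q : PMF T) : ℝ≥0∞ :=
  ∑' s, ∑' t, p s * q t * (if π s t then 1 else 0)

open Filter MeasureTheory

/-- The payoff of a mixed strategy against a uniform strategy on a finite set is the expectation
of the winning frequency. -/
theorem mixedPayoff_uniformOfFinset {S T : Type*} [MeasurableSpace S] [DiscreteMeasurableSpace S]
    [Countable S] (π : S → T → Prop) [∀ s t, Decidable (π s t)] (p : PMF S)
    (F : Finset T) (hF : F.Nonempty) :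
    mixedPayoff π p (PMF.uniformOfFinset F hF) =
      ∫⁻ s, ENNReal.ofReal ((∑ t ∈ F, if π s t then (1 : ℝ) else 0) / F.card) ∂p.toMeasure := by
  rw [lintegral_countable', mixedPayoff]
  refine tsum_congr fun s => ?_
  have hcard : (0 : ℝ) < F.card := by exact_mod_cast hF.card_pos
  simp only [mul_assoc]
  rw [ENNReal.tsum_mul_left, PMF.toMeasure_apply_singleton _ _ (MeasurableSet.singleton s),
    mul_comm, tsum_eq_sum (s := F), ENNReal.ofReal_div_of_pos hcard,
    ENNReal.ofReal_sum_of_nonneg (fun t _ => by split_ifs <;> norm_num), div_eq_mul_inv,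
    ENNReal.ofReal_natCast]
  · congr 1
    rw [Finset.sum_mul]
    refine Finset.sum_congr rfl fun t ht => ?_
    rw [PMF.uniformOfFinset_apply_of_mem hF ht, mul_comm]
    split_ifs <;> simp
  · intro t ht
    rw [PMF.uniformOfFinset_apply_of_notMem hF ht, zero_mul]

/-- An average of zeros and ones is at most one. -/
theorem sum_ite_one_div_le_one (P : ℕ → Prop) [DecidablePred P] (n : ℕ) :
    (∑ k ∈ Finset.range n, if P k then (1 : ℝ) else 0) / n ≤ 1 := by
  refine div_le_one_of_le₀ ?_ n.cast_nonneg
  calc (∑ k ∈ Finset.range n, if P k then (1 : ℝ) else 0)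
      ≤ ∑ _k ∈ Finset.range n, (1 : ℝ) := Finset.sum_le_sum fun k _ => by split_ifs <;> norm_num
    _ = n := by simp

/-- If every row of an `ℕ × ℕ` binary matrix has upper asymptotic density at most `α`,
then in the associated win-lose game, `sup_p inf_q π^mix(p,q) ≤ α`. -/
theorem supInf_le_of_row_upperDensity_le
    (a : ℕ → ℕ → Bool) (α : ℝ) (h0 : 0 ≤ α) (h1 : α ≤ 1)
    (hrow : ∀ i : ℕ, Filter.limsup
      (fun n : ℕ => (∑ k ∈ Finset.range n, if a i k then (1 : ℝ) else 0) / n)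
      Filter.atTop ≤ α) :
    (⨆ p : PMF ℕ, ⨅ q : PMF ℕ, mixedPayoff (fun i j => a i j = true) p q)
      ≤ ENNReal.ofReal α := by
  refine iSup_le fun p => ?_
  set f : ℕ → ℕ → ℝ := fun n i => (∑ k ∈ Finset.range n, if a i k then (1 : ℝ) else 0) / n
  have hf0 (n i : ℕ) : 0 ≤ f n i :=
    div_nonneg (Finset.sum_nonneg fun k _ => by split_ifs <;> norm_num) n.cast_nonneg
  have hf1 (n i : ℕ) : f n i ≤ 1 := sum_ite_one_div_le_one (fun k => a i k = true) n
  calc (⨅ q : PMF ℕ, mixedPayoff (fun i j => a i j = true) p q)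
      ≤ limsup (fun n => ∫⁻ i, ENNReal.ofReal (f n i) ∂p.toMeasure) atTop := by
        refine le_limsup_of_frequently_le (Eventually.frequently ?_)
        filter_upwards [eventually_ne_atTop 0] with n hn
        refine (iInf_le _ (PMF.uniformOfFinset (Finset.range n)
          (Finset.nonempty_range_iff.mpr hn))).trans_eq ?_
        rw [mixedPayoff_uniformOfFinset, Finset.card_range]
    _ ≤ ∫⁻ i, limsup (fun n => ENNReal.ofReal (f n i)) atTop ∂p.toMeasure :=
        limsup_lintegral_le (fun _ => 1) (fun n => measurable_from_nat)
          (fun n => ae_of_all _ fun i => ENNReal.ofReal_le_one.mpr (hf1 n i)) (by simp)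
    _ ≤ ∫⁻ _, ENNReal.ofReal α ∂p.toMeasure := by
        refine lintegral_mono fun i => ?_
        have hbdd : IsBoundedUnder (· ≤ ·) atTop fun n => f n i :=
          isBoundedUnder_of ⟨1, fun n => hf1 n i⟩
        have hcobdd : IsCoboundedUnder (· ≤ ·) atTop fun n => f n i :=
          (isBoundedUnder_of ⟨0, fun n => hf0 n i⟩ :
            IsBoundedUnder (· ≥ ·) atTop fun n => f n i).isCoboundedUnder_le
        have hmap := ENNReal.ofReal_mono.map_limsup_of_continuousAt (fun n => f n i)
          ENNReal.continuous_ofReal.continuousAt hbdd hcobdd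
        exact hmap.symm.trans_le (ENNReal.ofReal_le_ofReal (hrow i))
    _ = ENNReal.ofReal α := by simp
end

section
/- Let A = (a_{ij})_{i,j∈ℕ} be an ℕ × ℕ binary matrix in which the row and column upper/lower asymptotic densities are separated, i.e. there exist real numbers 0 ≤ α < β ≤ 1 such that every row has upper asymptotic density ≤ α and every column has lower asymptotic density ≥ β. Then A contains a fully lower-triangular submatrix: there exist injective sequences (s_i)_{i∈ℕ} and (t_j)_{j∈ℕ} in ℕ with a_{s_i t_j} = 1 if and only if i ≥ j. -/
open Filter Topology Finset

/-- The proportion of the first `n` natural numbers lying in `S`. -/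
noncomputable def initialDensity (S : Set ℕ) (n : ℕ) : ℝ :=
  (∑ k ∈ range n, S.indicator (fun _ => (1 : ℝ)) k) / n

lemma initialDensity_nonneg (S : Set ℕ) (n : ℕ) : 0 ≤ initialDensity S n :=
  div_nonneg (sum_nonneg fun _ _ => Set.indicator_nonneg (fun _ _ => zero_le_one) _)
    n.cast_nonneg

lemma initialDensity_mono {S T : Set ℕ} (h : S ⊆ T) (n : ℕ) :
    initialDensity S n ≤ initialDensity T n :=
  div_le_div_of_nonneg_right
    (sum_le_sum fun k _ => Set.indicator_le_indicator_of_subset h (fun _ => zero_le_one) k)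
    n.cast_nonneg

lemma initialDensity_le_one (S : Set ℕ) (n : ℕ) : initialDensity S n ≤ 1 := by
  refine div_le_one_of_le₀ ?_ n.cast_nonneg
  calc ∑ k ∈ range n, S.indicator (fun _ => (1 : ℝ)) k ≤ ∑ _k ∈ range n, (1 : ℝ) :=
        sum_le_sum fun k _ => Set.indicator_le_self' (fun _ _ => zero_le_one) k
    _ = n := by simp

lemma initialDensity_union {S T : Set ℕ} (h : Disjoint S T) (n : ℕ) :
    initialDensity (S ∪ T) n = initialDensity S n + initialDensity T n := by
  simp only [initialDensity, Set.indicator_union_of_disjoint h, sum_add_distrib, add_div]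

/-- A sequence of sets of finitely additive measure bounded below by a positive number has a
subsequence contained in a single ultrafilter. -/
lemma exists_ultrafilter_infinite_mem {X : Type*} (ν : Set X → ℝ)
    (hmono : ∀ S T, S ⊆ T → ν S ≤ ν T)
    (hadd : ∀ S T, Disjoint S T → ν (S ∪ T) = ν S + ν T)
    (E : ℕ → Set X) {δ : ℝ} (hδ : 0 < δ) (hE : ∀ k, δ ≤ ν (E k)) :
    ∃ p : Ultrafilter X, {k | E k ∈ p}.Infinite := by
  have hempty : ν ∅ = 0 := by simpa using hadd ∅ ∅ (by simp)
  have hsub (S T : Set X) : ν (S ∪ T) ≤ ν S + ν T := by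
    rw [← Set.union_sdiff_self, hadd _ _ Set.disjoint_sdiff_right]
    gcongr
    exact hmono _ _ Set.sdiff_subset
  let A (m n : ℕ) : Set X := ⋃ k ∈ Set.Ico m n, E k
  have hbdd (m : ℕ) : BddAbove (Set.range fun n => ν (A m n)) :=
    ⟨ν Set.univ, by rintro _ ⟨n, rfl⟩; exact hmono _ _ (Set.subset_univ _)⟩
  have hblock (m : ℕ) : ∃ n, ∀ k, m ≤ k → ν (E k \ A m n) ≤ δ / 2 * (1 / 2) ^ (m + 1) := by
    have hε : 0 < δ / 2 * (1 / 2) ^ (m + 1) := by positivity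
    obtain ⟨n, hn⟩ := exists_lt_of_lt_ciSup (sub_lt_self (⨆ n, ν (A m n)) hε)
    refine ⟨n, fun k hk => ?_⟩
    have hle : ν (A m n ∪ E k) ≤ ν (A m (max n (k + 1))) := by
      refine hmono _ _ (Set.union_subset ?_ ?_)
      · exact Set.biUnion_mono (Set.Ico_subset_Ico_right (le_max_left _ _)) fun _ _ => le_rfl
      · exact Set.subset_biUnion_of_mem (u := E)
          (⟨hk, lt_of_lt_of_le k.lt_succ_self (le_max_right _ _)⟩ : k ∈ Set.Ico m _)
    have hsup := le_ciSup (hbdd m) (max n (k + 1))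
    rw [← Set.union_sdiff_self, hadd _ _ Set.disjoint_sdiff_right] at hle
    linarith
  choose b hb using hblock
  let S (M : ℕ) : Set X := ⋂ m ∈ Set.Iio M, A m (b m)
  have hdiff (M : ℕ) : ∀ k, M ≤ k → ν (E k \ S M) ≤ δ / 2 * (1 - (1 / 2) ^ M) := by
    induction M with
    | zero => intro k _; simp [S, hempty]
    | succ M ih =>
      intro k hk
      have hS : E k \ S (M + 1) ⊆ (E k \ S M) ∪ (E k \ A M (b M)) := by
        rintro x ⟨hx, hxS⟩
        by_contra hcon
        simp only [Set.mem_union, Set.mem_sdiff, hx, true_and, not_or, not_not] at hcon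
        refine hxS (Set.mem_iInter₂.2 fun m hm => ?_)
        rcases Nat.lt_succ_iff_lt_or_eq.1 hm with h | rfl
        · exact Set.mem_iInter₂.1 hcon.1 m h
        · exact hcon.2
      have h₁ := (hmono _ _ hS).trans (hsub _ _)
      have h₂ := ih k (by omega)
      have h₃ := hb M k (by omega)
      have h₄ : ((1 : ℝ) / 2) ^ M = 2 * (1 / 2) ^ (M + 1) := by ring
      rw [h₄] at h₂
      linarith
  have hne (M : ℕ) : (S M).Nonempty := by
    by_contra hcon
    rw [Set.not_nonempty_iff_eq_empty] at hcon
    have h := hdiff M M le_rfl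
    rw [hcon, Set.sdiff_empty] at h
    have hpos : 0 < δ / 2 * (1 / 2) ^ M := by positivity
    linarith [hE M]
  have hanti : Antitone S := fun M N h =>
    Set.biInter_subset_biInter_left (Set.Iio_subset_Iio h)
  have : NeBot (⨅ M, 𝓟 (S M)) := by
    have : Nonempty X := ⟨(hne 0).some⟩
    refine iInf_neBot_of_directed ?_ fun M => principal_neBot_iff.2 (hne M)
    exact directed_of_isDirected_le fun M N h => principal_mono.2 (hanti h)
  refine ⟨Ultrafilter.of (⨅ M, 𝓟 (S M)), Set.infinite_of_forall_exists_gt fun m => ?_⟩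
  have hmem : A (m + 1) (b (m + 1)) ∈ Ultrafilter.of (⨅ M, 𝓟 (S M)) := by
    refine Ultrafilter.of_le _ (mem_of_superset (mem_iInf_of_mem (m + 2) (mem_principal_self _)) ?_)
    exact Set.biInter_subset_of_mem (show m + 1 ∈ Set.Iio (m + 2) by simp)
  obtain ⟨k, hk, hkp⟩ := (Ultrafilter.finite_biUnion_mem_iff (Set.finite_Ico _ _)).1 hmem
  exact ⟨k, hkp, hk.1⟩

/-- Along every ultrafilter, the initial densities of subsets of `ℕ` converge to a finitely
additive measure. -/
lemma exists_finitelyAdditive_tendsto_initialDensity (U : Ultrafilter ℕ) :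
    ∃ ν : Set ℕ → ℝ, (∀ S, Tendsto (initialDensity S) U (𝓝 (ν S))) ∧
      (∀ S T, S ⊆ T → ν S ≤ ν T) ∧ ∀ S T, Disjoint S T → ν (S ∪ T) = ν S + ν T := by
  have hlim (S : Set ℕ) : ∃ x, Tendsto (initialDensity S) U (𝓝 x) := by
    obtain ⟨x, -, hx⟩ := (isCompact_Icc (a := (0 : ℝ)) (b := 1)).ultrafilter_le_nhds
      (U.map (initialDensity S)) (le_principal_iff.2 (mem_map.2 (univ_mem' fun n =>
        ⟨initialDensity_nonneg S n, initialDensity_le_one S n⟩)))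
    exact ⟨x, hx⟩
  choose ν hν using hlim
  refine ⟨ν, hν, fun S T h => le_of_tendsto_of_tendsto' (hν S) (hν T) (initialDensity_mono h),
    fun S T h => tendsto_nhds_unique (hν _) ?_⟩
  exact ((hν S).add (hν T)).congr fun n => (initialDensity_union h n).symm

/-- If every column of a binary matrix has lower density at least `β`, then for each `γ < β`
some pointwise limit of rows contains a proportion at least `γ` of infinitely many initial
segments. -/
lemma exists_ultrafilter_frequently_le_initialDensity (C : ℕ → Set ℕ) {β γ : ℝ} (hγ : 0 ≤ γ)
    (hγβ : γ < β) (hC : ∀ j, ∀ c < β, ∀ᶠ n in atTop, c < initialDensity (C j) n) :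
    ∃ p : Ultrafilter ℕ, ∃ᶠ n in atTop, γ ≤ initialDensity {j | C j ∈ p} n := by
  obtain ⟨ν, hν, hmono, hadd⟩ := exists_finitelyAdditive_tendsto_initialDensity (hyperfilter ℕ)
  have hU : (hyperfilter ℕ : Filter ℕ) ≤ atTop := Nat.hyperfilter_le_atTop
  have hνC (j : ℕ) : β ≤ ν (C j) := le_of_forall_lt_imp_le_of_dense fun c hc =>
    ge_of_tendsto (hν (C j)) (hU ((hC j c hc).mono fun _ h => h.le))
  let G (N : ℕ) : Set ℕ := {i | γ ≤ initialDensity {j | i ∈ C j} (N + 1)}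
  have hG (N : ℕ) : β - γ ≤ ν (G N) := by
    have hN : (0 : ℝ) < ((N + 1 : ℕ) : ℝ) := by positivity
    have hpt (i : ℕ) : ∑ j ∈ range (N + 1), (C j).indicator (fun _ => (1 : ℝ)) i ≤
        ((N + 1 : ℕ) : ℝ) * ((G N).indicator (fun _ => (1 : ℝ)) i + γ) := by
      have heq : ∑ j ∈ range (N + 1), (C j).indicator (fun _ => (1 : ℝ)) i =
          ((N + 1 : ℕ) : ℝ) * initialDensity {j | i ∈ C j} (N + 1) := by
        rw [initialDensity, mul_div_cancel₀ _ hN.ne']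
        rfl
      rw [heq]
      refine mul_le_mul_of_nonneg_left ?_ hN.le
      by_cases hi : i ∈ G N
      · rw [Set.indicator_of_mem hi]
        linarith [initialDensity_le_one {j | i ∈ C j} (N + 1)]
      · rw [Set.indicator_of_notMem hi, zero_add]
        exact (not_le.1 hi).le
    have hle (n : ℕ) : ∑ j ∈ range (N + 1), initialDensity (C j) n ≤
        ((N + 1 : ℕ) : ℝ) * (initialDensity (G N) n + γ) := by
      rcases n.eq_zero_or_pos with rfl | hn
      · simp only [initialDensity, range_zero, sum_empty, zero_div, sum_const_zero, zero_add]
        positivity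
      have hn' : (0 : ℝ) < n := Nat.cast_pos.2 hn
      have h := sum_le_sum fun i (_ : i ∈ range n) => hpt i
      rw [sum_comm, ← mul_sum, sum_add_distrib, sum_const, card_range, nsmul_eq_mul] at h
      simp only [initialDensity]
      rw [← sum_div, div_le_iff₀ hn']
      refine h.trans_eq ?_
      field_simp
    have hlim := le_of_tendsto_of_tendsto' (tendsto_finsetSum _ fun j _ => hν (C j))
      (((hν (G N)).add_const γ).const_mul _) hle
    have hβ : ((N + 1 : ℕ) : ℝ) * β ≤ ∑ j ∈ range (N + 1), ν (C j) := by
      simpa using sum_le_sum fun j (_ : j ∈ range (N + 1)) => hνC j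
    linarith [le_of_mul_le_mul_left (hβ.trans hlim) hN]
  obtain ⟨p, hp⟩ := exists_ultrafilter_infinite_mem ν hmono hadd G (sub_pos.2 hγβ) hG
  refine ⟨p, frequently_atTop.2 fun m => ?_⟩
  obtain ⟨N, hN, hmN⟩ := hp.exists_gt m
  refine ⟨N + 1, by omega, ?_⟩
  have hagree : ∀ᶠ i in (p : Filter ℕ), ∀ j ∈ range (N + 1), (i ∈ C j ↔ C j ∈ p) := by
    rw [eventually_all_finset]
    intro j _
    by_cases hj : C j ∈ p
    · exact mem_of_superset hj fun i hi => ⟨fun _ => hj, fun _ => hi⟩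
    · exact mem_of_superset (Ultrafilter.compl_mem_iff_notMem.2 hj) fun i hi =>
        ⟨fun h => absurd h hi, fun h => absurd h hj⟩
  obtain ⟨i, hi, hiG⟩ := (hagree.and hN).exists
  refine hiG.trans_eq ?_
  unfold initialDensity
  congr 1
  refine sum_congr rfl fun j hj => ?_
  by_cases hj' : C j ∈ p
  · rw [Set.indicator_of_mem (show j ∈ {j | i ∈ C j} from (hi j hj).2 hj'),
      Set.indicator_of_mem (show j ∈ {j | C j ∈ p} from hj')]
  · rw [Set.indicator_of_notMem (show j ∉ {j | i ∈ C j} from fun h => hj' ((hi j hj).1 h)),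
      Set.indicator_of_notMem (show j ∉ {j | C j ∈ p} from hj')]

/-- Let `J` have upper density greater than `α`, and let the sets `R k` have upper density at most
`α`. Then infinitely many of the sets `J \ R k` lie in a single ultrafilter. -/
lemma exists_ultrafilter_infinite_diff_mem (R : ℕ → Set ℕ) (J : Set ℕ) {α γ : ℝ} (hαγ : α < γ)
    (hR : ∀ k, ∀ c > α, ∀ᶠ n in atTop, initialDensity (R k) n < c)
    (hJ : ∃ᶠ n in atTop, γ ≤ initialDensity J n) :
    ∃ q : Ultrafilter ℕ, {k | J \ R k ∈ q}.Infinite := by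
  have : NeBot (atTop ⊓ 𝓟 {n | γ ≤ initialDensity J n}) := frequently_mem_iff_neBot.1 hJ
  let U := Ultrafilter.of (atTop ⊓ 𝓟 {n | γ ≤ initialDensity J n})
  have hU : (U : Filter ℕ) ≤ atTop := (Ultrafilter.of_le _).trans inf_le_left
  have hUJ : ∀ᶠ n in (U : Filter ℕ), γ ≤ initialDensity J n :=
    le_principal_iff.1 ((Ultrafilter.of_le _).trans inf_le_right)
  obtain ⟨ν, hν, hmono, hadd⟩ := exists_finitelyAdditive_tendsto_initialDensity U
  refine exists_ultrafilter_infinite_mem ν hmono hadd _ (sub_pos.2 hαγ) fun k => ?_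
  have hνJ : γ ≤ ν J := ge_of_tendsto (hν J) hUJ
  have hνR : ν (R k) ≤ α := le_of_forall_gt_imp_ge_of_dense fun c hc =>
    le_of_tendsto (hν (R k)) (hU ((hR k c hc).mono fun _ h => h.le))
  have h := hmono J (R k ∪ (J \ R k)) (by rw [Set.union_sdiff_self]; exact Set.subset_union_right)
  rw [hadd _ _ Set.disjoint_sdiff_right] at h
  linarith


/-- Theorem 4.5: if in an `ℕ × ℕ` binary matrix the row and column upper/lower
asymptotic densities are separated (every row has upper density at most `α` and every
column has lower density at least `β`, where `α < β`), then the matrix contains a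
fully lower-triangular submatrix. -/
theorem lower_triangular_submatrix_of_density_separation
    (a : ℕ → ℕ → Bool) (α β : ℝ) (h0 : 0 ≤ α) (hαβ : α < β) (h1 : β ≤ 1)
    (hrow : ∀ i : ℕ, Filter.limsup
      (fun n : ℕ => (∑ k ∈ Finset.range n, if a i k then (1 : ℝ) else 0) / n)
      Filter.atTop ≤ α)
    (hcol : ∀ j : ℕ, β ≤ Filter.liminf
      (fun n : ℕ => (∑ k ∈ Finset.range n, if a k j then (1 : ℝ) else 0) / n)
      Filter.atTop) :
    ∃ (s t : ℕ → ℕ), Function.Injective s ∧ Function.Injective t ∧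
      ∀ i j, a (s i) (t j) = true ↔ j ≤ i := by

  have hrowd (i : ℕ) : (fun n : ℕ => (∑ k ∈ range n, if a i k then (1 : ℝ) else 0) / n) =
      initialDensity {j | a i j = true} := by
    funext n; simp only [initialDensity, Set.indicator, Set.mem_ofPred_eq]
  have hcold (j : ℕ) : (fun n : ℕ => (∑ k ∈ range n, if a k j then (1 : ℝ) else 0) / n) =
      initialDensity {i | a i j = true} := by
    funext n; simp only [initialDensity, Set.indicator, Set.mem_ofPred_eq]
  have hR (i : ℕ) : ∀ c > α, ∀ᶠ n in atTop, initialDensity {j | a i j = true} n < c := by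
    intro c hc
    have h := hrow i
    rw [hrowd] at h
    exact eventually_lt_of_limsup_lt (h.trans_lt hc)
      (isBoundedUnder_of ⟨1, initialDensity_le_one _⟩)
  have hC (j : ℕ) : ∀ c < β, ∀ᶠ n in atTop, c < initialDensity {i | a i j = true} n := by
    intro c hc
    have h := hcol j
    rw [hcold] at h
    exact eventually_lt_of_lt_liminf (hc.trans_le h)
      (isBoundedUnder_of ⟨0, initialDensity_nonneg _⟩)
  obtain ⟨γ, hαγ, hγβ⟩ := exists_between hαβ
  obtain ⟨p, hp⟩ := exists_ultrafilter_frequently_le_initialDensity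
    (fun j => {i | a i j = true}) (h0.trans hαγ.le) hγβ hC
  set J : Set ℕ := {j | {i | a i j = true} ∈ p}
  have hf (k : ℕ) : ∃ i, ∀ j ∈ J, j < k → a i j = true := by
    have h : ∀ᶠ i in (p : Filter ℕ), ∀ j ∈ range k, j ∈ J → a i j = true := by
      rw [eventually_all_finset]
      intro j _
      by_cases hj : j ∈ J
      · exact mem_of_superset hj fun i hi _ => hi
      · exact Eventually.of_forall fun i h => absurd h hj
    obtain ⟨i, hi⟩ := h.exists
    exact ⟨i, fun j hj hjk => hi j (mem_range.2 hjk) hj⟩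
  choose f hf using hf
  obtain ⟨q, hq⟩ := exists_ultrafilter_infinite_diff_mem
    (fun k => {j | a (f k) j = true}) J hαγ (fun k => hR (f k)) hp
  have hJq : J ∈ q := mem_of_superset hq.nonempty.some_mem Set.sdiff_subset
  obtain ⟨g, hgP, hgr⟩ := exists_seq_of_forall_finset_exists
    (fun x : ℕ × ℕ => J \ {j | a (f x.1) j = true} ∈ q ∧ x.2 ∈ J ∧ x.2 < x.1)
    (fun x y => y.2 ∈ J \ {j | a (f x.1) j = true} ∧ x.2 < y.1) (by
      intro s hs
      have h : ∀ᶠ t in (q : Filter ℕ), ∀ x ∈ s, t ∈ J \ {j | a (f x.1) j = true} := by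
        rw [eventually_all_finset]
        exact fun x hx => (hs x hx).1
      obtain ⟨t, ht, htJ⟩ := (h.and hJq).exists
      obtain ⟨k, hk, hkt⟩ := hq.exists_gt (max t (s.sup Prod.snd))
      refine ⟨(k, t), ⟨hk, htJ, (le_max_left _ _).trans_lt hkt⟩, fun x hx => ⟨ht x hx, ?_⟩⟩
      exact ((le_sup (f := Prod.snd) hx).trans (le_max_right _ _)).trans_lt hkt)
  have key (i j : ℕ) : a (f (g i).1) (g j).2 = true ↔ j ≤ i := by
    rcases lt_or_ge i j with h | h
    · exact iff_of_false (hgr i j h).1.2 h.not_ge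
    · refine iff_of_true (hf _ _ (hgP j).2.1 ?_) h
      rcases h.eq_or_lt with rfl | h
      · exact (hgP j).2.2
      · exact (hgr j i h).2
  refine ⟨fun i => f (g i).1, fun j => (g j).2, fun i i' h => ?_, fun j j' h => ?_, key⟩
  · simp only at h
    exact le_antisymm ((key i' i).1 (h ▸ (key i i).2 le_rfl))
      ((key i i').1 (h ▸ (key i' i').2 le_rfl))
  · simp only at h
    exact le_antisymm ((key j' j).1 (h ▸ (key j' j').2 le_rfl))
      ((key j j').1 (h ▸ (key j j).2 le_rfl))
end

section
/- Let H = (V, E) be a hypergraph and let G(H) = (V, E, π) be the associated two-person win-lose game in which player 1 chooses a vertex v ∈ V, player 2 chooses an edge e ∈ E, and π(v, e) = 1 if and only if v ∈ e. Then (with values in [0,∞] and the conventions 1/∞ = 0, 1/0 = ∞): sup over mixed strategies p on V of inf over mixed strategies q on E of π^mix(p,q) equals 1/τ*(H), and inf over mixed strategies q on E of sup over mixed strategies p on V of π^mix(p,q) equals 1/ν*(H). -/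
open scoped ENNReal NNReal Classical

/-- `ν*(H)`: the supremum of the sizes of fractional matchings of the hypergraph with
vertex set `V` and edge set `E`, as an element of `[0,∞]`. -/
noncomputable def nuStar {V : Type*} (E : Set (Set V)) : ℝ≥0∞ :=
  sSup {x | ∃ f : E → ℝ≥0,
    (∀ v : V, (∑' e : E, if v ∈ (e : Set V) then (f e : ℝ≥0∞) else 0) ≤ 1) ∧
    x = ∑' e : E, (f e : ℝ≥0∞)}

/-- `τ*(H)`: the infimum of the sizes of fractional covers of the hypergraph with
vertex set `V` and edge set `E`, as an element of `[0,∞]`. -/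
noncomputable def tauStar {V : Type*} (E : Set (Set V)) : ℝ≥0∞ :=
  sInf {x | ∃ g : V → ℝ≥0,
    (∀ e ∈ E, 1 ≤ ∑' v : e, (g v : ℝ≥0∞)) ∧
    x = ∑' v : V, (g v : ℝ≥0∞)}

/-- The expected payoff as player 1's average of the payoffs of the pure strategies. -/
theorem mixedPayoff_eq_tsum_left {S T : Type*} (π : S → T → Prop) (p : PMF S) (q : PMF T) :
    mixedPayoff π p q = ∑' s, p s * ∑' t, if π s t then q t else 0 := by
  simp only [mixedPayoff, ← ENNReal.tsum_mul_left, mul_ite, mul_one, mul_zero]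

/-- The expected payoff as player 2's average of the payoffs of the pure strategies. -/
theorem mixedPayoff_eq_tsum_right {S T : Type*} (π : S → T → Prop) (p : PMF S) (q : PMF T) :
    mixedPayoff π p q = ∑' t, q t * ∑' s, if π s t then p s else 0 := by
  rw [mixedPayoff, ENNReal.tsum_comm]
  simp only [← ENNReal.tsum_mul_left, mul_ite, mul_one, mul_zero, mul_comm (p _)]

theorem PMF.tsum_pure_mul {S : Type*} (s : S) (F : S → ℝ≥0∞) :
    ∑' x, PMF.pure s x * F x = F s := by
  rw [tsum_eq_single s]
  · simp
  · intro x hx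
    simp [hx]

theorem mixedPayoff_pure_left {S T : Type*} (π : S → T → Prop) (s : S) (q : PMF T) :
    mixedPayoff π (PMF.pure s) q = ∑' t, if π s t then q t else 0 := by
  rw [mixedPayoff_eq_tsum_left, PMF.tsum_pure_mul]

theorem mixedPayoff_pure_right {S T : Type*} (π : S → T → Prop) (p : PMF S) (t : T) :
    mixedPayoff π p (PMF.pure t) = ∑' s, if π s t then p s else 0 := by
  rw [mixedPayoff_eq_tsum_right, PMF.tsum_pure_mul]

theorem PMF.le_tsum_mul {S : Type*} (p : PMF S) (F : S → ℝ≥0∞) {c : ℝ≥0∞} (h : ∀ s, c ≤ F s) :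
    c ≤ ∑' s, p s * F s := by
  calc c = ∑' s, p s * c := by rw [ENNReal.tsum_mul_right, p.tsum_coe, one_mul]
    _ ≤ _ := ENNReal.tsum_le_tsum fun s => mul_le_mul_right (h s) _

theorem PMF.tsum_mul_le {S : Type*} (p : PMF S) (F : S → ℝ≥0∞) {c : ℝ≥0∞} (h : ∀ s, F s ≤ c) :
    ∑' s, p s * F s ≤ c := by
  calc _ ≤ ∑' s, p s * c := ENNReal.tsum_le_tsum fun s => mul_le_mul_right (h s) _
    _ = c := by rw [ENNReal.tsum_mul_right, p.tsum_coe, one_mul]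

theorem PMF.tsum_ite_le_one {S : Type*} (p : PMF S) (P : S → Prop) :
    (∑' s, if P s then p s else 0) ≤ 1 := by
  rw [← p.tsum_coe]
  refine ENNReal.tsum_le_tsum fun s => ?_
  split_ifs <;> simp

theorem tsum_ite_mul_right {S : Type*} (P : S → Prop) (F : S → ℝ≥0∞) (c : ℝ≥0∞) :
    (∑' s, if P s then F s * c else 0) = (∑' s, if P s then F s else 0) * c := by
  simp only [← ENNReal.tsum_mul_right, ite_mul, zero_mul]

theorem tsum_subtype_eq_tsum_ite {V : Type*} (e : Set V) (g : V → ℝ≥0∞) :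
    ∑' v : e, g v = ∑' v, if v ∈ e then g v else 0 := by
  rw [tsum_subtype e g]
  rfl

/-- A mixed strategy of player 1 that guarantees `c` gives a fractional cover of size `c⁻¹`. -/
theorem le_inv_tauStar {V : Type*} {E : Set (Set V)} (hE : E.Nonempty) (p : PMF V) {c : ℝ≥0∞}
    (h : ∀ e ∈ E, c ≤ ∑' v, if v ∈ e then p v else 0) : c ≤ (tauStar E)⁻¹ := by
  obtain rfl | hc := eq_or_ne c 0
  · exact zero_le
  have hctop : c ≠ ∞ := by
    obtain ⟨e, he⟩ := hE
    exact ne_top_of_le_ne_top ENNReal.one_ne_top ((h e he).trans (p.tsum_ite_le_one _))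
  rw [ENNReal.le_inv_iff_le_inv]
  have hg (v : V) : (((p v * c⁻¹).toNNReal : ℝ≥0) : ℝ≥0∞) = p v * c⁻¹ :=
    ENNReal.coe_toNNReal (ENNReal.mul_ne_top (p.apply_ne_top v) (ENNReal.inv_ne_top.2 hc))
  refine sInf_le ⟨fun v => (p v * c⁻¹).toNNReal, fun e he => ?_, ?_⟩
  · simp only [hg]
    rw [tsum_subtype_eq_tsum_ite e fun v => p v * c⁻¹, tsum_ite_mul_right,
      ← ENNReal.mul_inv_cancel hc hctop]
    exact mul_le_mul_left (h e he) _
  · simp only [hg]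
    rw [ENNReal.tsum_mul_right, p.tsum_coe, one_mul]

/-- Normalizing a fractional cover gives a mixed strategy guaranteeing the inverse of its size. -/
theorem inv_tsum_le_iSup_mixedPayoff {V : Type*} {E : Set (Set V)} (hE : E.Nonempty)
    (g : V → ℝ≥0) (hg : ∀ e ∈ E, 1 ≤ ∑' v : e, (g v : ℝ≥0∞)) :
    (∑' v, (g v : ℝ≥0∞))⁻¹ ≤
      ⨆ p : PMF V, ⨅ q : PMF E, mixedPayoff (fun (v : V) (e : E) => v ∈ (e : Set V)) p q := by
  by_cases htop : ∑' v, (g v : ℝ≥0∞) = ∞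
  · simp [htop]
  have h0 : ∑' v, (g v : ℝ≥0∞) ≠ 0 := by
    obtain ⟨e, he⟩ := hE
    intro h
    have := hg e he
    simp_all
  refine le_iSup_of_le (PMF.normalize (fun v => (g v : ℝ≥0∞)) h0 htop) (le_iInf fun q => ?_)
  rw [mixedPayoff_eq_tsum_right]
  refine q.le_tsum_mul _ fun e => ?_
  simp only [PMF.normalize_apply]
  rw [tsum_ite_mul_right, ← tsum_subtype_eq_tsum_ite (e : Set V) fun v => (g v : ℝ≥0∞)]
  exact le_mul_of_one_le_left zero_le (hg e e.2)

/-- A mixed strategy of player 2 that concedes at most `c` gives fractional matchings of size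
up to `c⁻¹`. -/
theorem inv_nuStar_le {V : Type*} {E : Set (Set V)} (q : PMF E) {c : ℝ≥0∞}
    (h : ∀ v : V, (∑' e : E, if v ∈ (e : Set V) then q e else 0) ≤ c) : (nuStar E)⁻¹ ≤ c := by
  rw [ENNReal.inv_le_iff_inv_le]
  refine ENNReal.le_of_forall_nnreal_lt fun r hr => ?_
  have hrc : c * r ≤ 1 := (mul_le_mul_right hr.le c).trans (ENNReal.mul_inv_le_one c)
  have hf (e : E) : (((q e * r).toNNReal : ℝ≥0) : ℝ≥0∞) = q e * r :=
    ENNReal.coe_toNNReal (ENNReal.mul_ne_top (q.apply_ne_top e) ENNReal.coe_ne_top)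
  refine le_sSup ⟨fun e => (q e * r).toNNReal, fun v => ?_, ?_⟩
  · simp only [hf]
    rw [tsum_ite_mul_right]
    exact (mul_le_mul_left (h v) _).trans hrc
  · simp only [hf]
    rw [ENNReal.tsum_mul_right, q.tsum_coe, one_mul]

/-- Normalizing finite pieces of a fractional matching gives mixed strategies of player 2 that
concede no more than the inverse of its size in the limit. -/
theorem iInf_mixedPayoff_le_inv_tsum {V : Type*} {E : Set (Set V)} (f : E → ℝ≥0)
    (hf : ∀ v : V, (∑' e : E, if v ∈ (e : Set V) then (f e : ℝ≥0∞) else 0) ≤ 1) :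
    (⨅ q : PMF E, ⨆ p : PMF V, mixedPayoff (fun (v : V) (e : E) => v ∈ (e : Set V)) p q) ≤
      (∑' e, (f e : ℝ≥0∞))⁻¹ := by
  rw [ENNReal.tsum_eq_iSup_sum, ENNReal.inv_iSup]
  refine le_iInf fun s => ?_
  have hs : ∑' e, (if e ∈ s then (f e : ℝ≥0∞) else 0) = ∑ e ∈ s, (f e : ℝ≥0∞) := by
    rw [tsum_eq_sum (s := s) fun e he => if_neg he]
    exact Finset.sum_congr rfl fun e he => if_pos he
  by_cases h0 : ∑ e ∈ s, (f e : ℝ≥0∞) = 0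
  · simp [h0]
  have htop : ∑ e ∈ s, (f e : ℝ≥0∞) ≠ ∞ := ENNReal.sum_ne_top.2 fun e _ => ENNReal.coe_ne_top
  refine iInf_le_of_le (PMF.normalize (fun e => if e ∈ s then (f e : ℝ≥0∞) else 0)
    (hs ▸ h0) (hs ▸ htop)) (iSup_le fun p => ?_)
  rw [mixedPayoff_eq_tsum_left]
  refine p.tsum_mul_le _ fun v => ?_
  simp only [PMF.normalize_apply]
  rw [tsum_ite_mul_right, hs]
  refine mul_le_of_le_one_left zero_le (le_trans (ENNReal.tsum_le_tsum fun e => ?_) (hf v))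
  split_ifs <;> simp

/-- In the game `G(H)` associated with a hypergraph `H = (V, E)` (player 1 picks a
vertex, player 2 picks an edge, player 1 wins iff the vertex lies in the edge),
`sup_p inf_q = 1/τ*(H)` and `inf_q sup_p = 1/ν*(H)` (with `1/∞ = 0`, `1/0 = ∞`). -/
theorem hypergraph_game_values
    {V : Type*} [Nonempty V] (E : Set (Set V)) (hE : E.Nonempty) :
    (⨆ p : PMF V, ⨅ q : PMF E, mixedPayoff (fun (v : V) (e : E) => v ∈ (e : Set V)) p q)
        = (tauStar E)⁻¹ ∧
    (⨅ q : PMF E, ⨆ p : PMF V, mixedPayoff (fun (v : V) (e : E) => v ∈ (e : Set V)) p q)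
        = (nuStar E)⁻¹ := by
  constructor
  · refine le_antisymm (iSup_le fun p => le_inv_tauStar hE p fun e he => ?_) ?_
    · exact (iInf_le _ (PMF.pure ⟨e, he⟩)).trans_eq (mixedPayoff_pure_right _ _ _)
    · rw [tauStar, ENNReal.inv_sInf]
      refine iSup₂_le ?_
      rintro _ ⟨g, hg, rfl⟩
      exact inv_tsum_le_iSup_mixedPayoff hE g hg
  · refine le_antisymm ?_ (le_iInf fun q => inv_nuStar_le q fun v => ?_)
    · rw [nuStar, ENNReal.inv_sSup]
      refine le_iInf₂ ?_
      rintro _ ⟨f, hf, rfl⟩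
      exact iInf_mixedPayoff_le_inv_tsum f hf
    · rw [← mixedPayoff_pure_left (fun (v : V) (e : E) => v ∈ (e : Set V))]
      exact le_iSup (fun p : PMF V =>
        mixedPayoff (fun (v : V) (e : E) => v ∈ (e : Set V)) p q) (PMF.pure v)
end

section
/- Let H = (V, E) be a hypergraph. Then every partial sub-hypergraph H' of H satisfies the weak duality property ν*(H') = τ*(H') if and only if H has no partial sub-hypergraph isomorphic to the tail hypergraph; equivalently, if and only if there do not exist an injective sequence of vertices (v_i)_{i∈ℕ} in V and an injective sequence of edges (e_j)_{j∈ℕ} in E with v_i ∈ e_j if and only if i ≥ j. -/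
open scoped ENNReal NNReal Classical

/-- The edge set of the partial sub-hypergraph of `(V, E)` determined by a vertex
subset `V'` and an edge subset `E₀ ⊆ E`: the traces `e ∩ V'` for `e ∈ E₀`. -/
def subEdges {V : Type*} (V' : Set V) (E₀ : Set (Set V)) : Set (Set V') :=
  {A | ∃ e ∈ E₀, A = (Subtype.val ⁻¹' e : Set V')}

open MeasureTheory Filter Topology

/-- If every member of a nonempty convex set of continuous functions on a compact space is
nonnegative somewhere, then some nonzero finite measure makes all their integrals nonnegative. -/
theorem exists_measure_forall_integral_nonneg {K : Type*} [TopologicalSpace K] [CompactSpace K]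
    [T2Space K] [MeasurableSpace K] [BorelSpace K] {C : Set C(K, ℝ)} (hC : Convex ℝ C)
    (hne : C.Nonempty) (hpos : ∀ h ∈ C, ∃ x, 0 ≤ h x) :
    ∃ μ : Measure K, IsFiniteMeasure μ ∧ μ ≠ 0 ∧ ∀ h ∈ C, 0 ≤ ∫ x, h x ∂μ := by
  let N : Set C(K, ℝ) := {h | ∀ x, h x < 0}
  have hNo : IsOpen N := by
    have := ContinuousMap.isOpen_setOfPred_mapsTo (X := K) (Y := ℝ) isCompact_univ
      (isOpen_Iio (a := 0))
    convert this using 1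
    ext h
    simp [N, Set.MapsTo]
  have hNc : Convex ℝ N := by
    intro a ha b hb s t hs ht hst x
    have h1 := ha x
    have h2 := hb x
    simp only [ContinuousMap.add_apply, ContinuousMap.smul_apply, smul_eq_mul]
    rcases hs.eq_or_lt with rfl | hs
    · simp only [zero_add] at hst
      subst hst
      simpa using h2
    · nlinarith
  have hd : Disjoint N C := by
    rw [Set.disjoint_left]
    intro h hN hhC
    obtain ⟨x, hx⟩ := hpos h hhC
    exact absurd (hN x) (not_lt.2 hx)
  obtain ⟨f, u, hf, hfC⟩ := geometric_hahn_banach_open hNc hNo hC hd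
  have hsmul : ∀ a ∈ N, ∀ t : ℝ, 0 < t → t * f a < u := by
    intro a ha t ht
    have : t • a ∈ N := fun x => by
      simpa using mul_neg_of_pos_of_neg ht (ha x)
    simpa using hf _ this
  have hN1 : (-1 : C(K, ℝ)) ∈ N := fun x => by simp
  have hu : 0 ≤ u := by
    by_contra! hu
    have h1 := hsmul _ hN1
    have h2 : f (-1) < 0 := by linarith [h1 1 one_pos]
    have := h1 (u / (f (-1))) (div_pos_of_neg_of_neg hu h2)
    rw [div_mul_cancel₀ _ h2.ne] at this
    exact lt_irrefl _ this
  have hfN : ∀ a ∈ N, f a ≤ 0 := by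
    intro a ha
    by_contra! h
    have := hsmul a ha ((u + 1) / f a) (by positivity)
    rw [div_mul_cancel₀ _ h.ne'] at this
    linarith
  have hfpos : ∀ h : C(K, ℝ), 0 ≤ h → 0 ≤ f h := by
    intro h hh
    have h1 : 0 ≤ f 1 := by simpa using hfN _ hN1
    have key : ∀ δ : ℝ, 0 < δ → 0 ≤ f h + δ * f 1 := by
      intro δ hδ
      have : (-(h + δ • 1) : C(K, ℝ)) ∈ N := fun x => by
        have : 0 ≤ h x := hh x
        simp only [ContinuousMap.neg_apply, ContinuousMap.add_apply, ContinuousMap.smul_apply,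
          ContinuousMap.one_apply, smul_eq_mul, mul_one]
        linarith
      have := hfN _ this
      simp only [map_neg, map_add, map_smul, smul_eq_mul] at this
      linarith
    by_contra! hneg
    have := key (-f h / (2 * (f 1 + 1))) (by apply div_pos <;> linarith)
    have h2 : -f h / (2 * (f 1 + 1)) * f 1 ≤ -f h / 2 := by
      rw [div_mul_eq_mul_div, div_le_div_iff₀ (by linarith) (by norm_num)]
      nlinarith
    linarith
  let Λ : CompactlySupportedContinuousMap K ℝ →ₚ[ℝ] ℝ := PositiveLinearMap.mk₀
    { toFun := fun g => f (CompactlySupportedContinuousMap.continuousMapEquiv.symm g)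
      map_add' := fun a b => by
        rw [← map_add]; rfl
      map_smul' := fun a b => by
        rw [RingHom.id_apply, ← map_smul]; rfl }
    (fun g hg => hfpos _ fun x => hg x)
  have hint : ∀ h : C(K, ℝ), ∫ x, h x ∂(RealRMK.rieszMeasure Λ) = f h := fun h =>
    RealRMK.integral_rieszMeasure Λ (CompactlySupportedContinuousMap.continuousMapEquiv h)
  refine ⟨RealRMK.rieszMeasure Λ, inferInstance, ?_, fun h hh => ?_⟩
  · intro h0
    have hf0 : ∀ h, f h = 0 := fun h => by rw [← hint h, h0]; simp
    have := hf _ hN1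
    obtain ⟨h, hh⟩ := hne
    have h2 := hfC h hh
    rw [hf0] at this h2
    linarith
  · rw [hint]
    exact hu.trans (hfC h hh)

/-- A sequential Fatou-type minimax principle: if all convex combinations of a uniformly bounded
sequence of continuous functions on a compact space reach the level `c`, then for `c' < c` the
functions themselves exceed `c'` infinitely often at a common point. -/
theorem exists_frequently_le_of_convexHull {K : Type*} [TopologicalSpace K] [CompactSpace K]
    [T2Space K] (h : ℕ → C(K, ℝ)) (B : ℝ) (hB : ∀ n x, |h n x| ≤ B) {c c' : ℝ} (hc : c' < c)
    (hconv : ∀ g ∈ convexHull ℝ (Set.range h), ∃ x, c ≤ g x) :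
    ∃ x, ∃ᶠ n in atTop, c' ≤ h n x := by
  borelize K
  let C : Set C(K, ℝ) := (fun g => g - ContinuousMap.const K c) '' convexHull ℝ (Set.range h)
  have hC : Convex ℝ C := by
    have := (convex_convexHull ℝ (Set.range h)).translate (-ContinuousMap.const K c)
    simpa only [C, sub_eq_neg_add] using this
  obtain ⟨μ, _, hμ0, hμ⟩ := exists_measure_forall_integral_nonneg hC
    ⟨_, Set.mem_image_of_mem _ (subset_convexHull ℝ _ ⟨0, rfl⟩)⟩ (by
      rintro _ ⟨g, hg, rfl⟩
      obtain ⟨x, hx⟩ := hconv g hg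
      exact ⟨x, by simpa using hx⟩)
  have hmass : 0 < μ.real Set.univ := by
    rw [measureReal_def, ENNReal.toReal_pos_iff]
    exact ⟨by simpa [pos_iff_ne_zero] using hμ0, measure_lt_top _ _⟩
  by_contra! hcon
  have hev : ∀ x, ∀ᶠ n in atTop, h n x < c' := fun x => by
    simpa [Filter.not_frequently] using hcon x
  have hi : ∀ g : C(K, ℝ), Integrable g μ := fun g =>
    g.continuous.integrable_of_hasCompactSupport (HasCompactSupport.of_compactSpace g)
  have hlim : Tendsto (fun n => ∫ x, max (h n x - c') 0 ∂μ) atTop (𝓝 (∫ _, (0 : ℝ) ∂μ)) := by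
    refine tendsto_integral_of_dominated_convergence (fun _ => B + |c'|) ?_ (integrable_const _)
      ?_ ?_
    · intro n
      exact (((h n).continuous.sub continuous_const).max continuous_const).aestronglyMeasurable
    · intro n
      refine Eventually.of_forall fun x => ?_
      have := abs_le.1 (hB n x)
      have h2 := neg_abs_le c'
      rw [Real.norm_eq_abs, abs_of_nonneg (le_max_right _ _)]
      refine max_le (by linarith) (by linarith [abs_nonneg c', abs_nonneg (h n x), hB n x])
    · refine Eventually.of_forall fun x => ?_
      refine tendsto_const_nhds.congr' ?_
      filter_upwards [hev x] with n hn
      rw [max_eq_right (by linarith)]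
  have hlow : ∀ n, (c - c') * μ.real Set.univ ≤ ∫ x, max (h n x - c') 0 ∂μ := by
    intro n
    have h1 : 0 ≤ ∫ x, (h n x - c) ∂μ :=
      hμ _ (Set.mem_image_of_mem _ (subset_convexHull ℝ _ ⟨n, rfl⟩))
    rw [integral_sub (hi _) (integrable_const _), integral_const, smul_eq_mul] at h1
    have h2 : ∫ x, (h n x - c') ∂μ ≤ ∫ x, max (h n x - c') 0 ∂μ :=
      integral_mono ((hi _).sub (integrable_const _))
        (((hi _).sub (integrable_const _)).sup (integrable_zero _ _ _)) fun x => le_max_left _ _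
    rw [integral_sub (hi _) (integrable_const _), integral_const, smul_eq_mul] at h2
    linarith
  have := ge_of_tendsto' hlim hlow
  simp only [integral_zero] at this
  nlinarith [mul_pos (sub_pos.2 hc) hmass]

/-- The indicator of the clopen set of ultrafilters containing `A`. -/
noncomputable def ultrafilterIndicator {Z : Type*} (A : Set Z) : C(Ultrafilter Z, ℝ) where
  toFun U := if A ∈ U then 1 else 0
  continuous_toFun := by
    have hA : IsClopen {U : Ultrafilter Z | A ∈ U} :=
      ⟨ultrafilter_isClosed_basic A, ultrafilter_isOpen_basic A⟩
    exact continuous_const.if (fun U hU => by simp [hA.frontier_eq] at hU) continuous_const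

theorem ultrafilterIndicator_apply {Z : Type*} (A : Set Z) (U : Ultrafilter Z) :
    ultrafilterIndicator A U = if A ∈ U then 1 else 0 := rfl

theorem linearCombination_mono {I : Type*} {q : I →₀ ℝ} (hq : ∀ i, 0 ≤ q i) {φ ψ : I → ℝ}
    (h : ∀ i, φ i ≤ ψ i) :
    Finsupp.linearCombination ℝ φ q ≤ Finsupp.linearCombination ℝ ψ q := by
  simp only [Finsupp.linearCombination_apply, Finsupp.sum, smul_eq_mul]
  exact Finset.sum_le_sum fun i _ => mul_le_mul_of_nonneg_left (h i) (hq i)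

/-- In a tail-free incidence relation, a family `G` of edges with the finite intersection property
admits a sequence of vertices such that the sets of indices missed by edges in `G` form a
precompact family. -/
theorem exists_seq_forall_infinite {V I : Type*} (r : V → I → Prop)
    (htail : ¬ ∃ (v : ℕ → V) (e : ℕ → I), ∀ m k, r (v m) (e k) ↔ k ≤ m)
    {G : Set I} (hG : G.Nonempty) (hfip : ∀ F : Finset I, ↑F ⊆ G → ∃ v, ∀ i ∈ F, r v i) :
    ∃ v : ℕ → V, ∀ s : Set ℕ, s.Infinite →
      ∃ t : Finset ℕ, ↑t ⊆ s ∧ ∀ i ∈ G, ∃ n ∈ t, r (v n) i := by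
  have he : ∀ W : Finset V, ∃ i ∈ G, (∃ j ∈ G, ∀ w ∈ W, ¬ r w j) → ∀ w ∈ W, ¬ r w i := by
    intro W
    by_cases h : ∃ j ∈ G, ∀ w ∈ W, ¬ r w j
    · obtain ⟨j, hj, hjW⟩ := h
      exact ⟨j, hj, fun _ => hjW⟩
    · obtain ⟨j, hj⟩ := hG
      exact ⟨j, hj, fun h' => absurd h' h⟩
  choose e heG he using he
  have hp : ∀ A : Finset V, ∃ v, ∀ W ⊆ A, r v (e W) := by
    intro A
    obtain ⟨v, hv⟩ := hfip (A.powerset.image e) (by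
      intro i hi
      simp only [Finset.coe_image, Set.mem_image] at hi
      obtain ⟨W, -, rfl⟩ := hi
      exact heG W)
    exact ⟨v, fun W hW => hv _ (Finset.mem_image_of_mem e (Finset.mem_powerset.2 hW))⟩
  choose pick hpick using hp
  let A : ℕ → Finset V := fun n => Nat.rec ∅ (fun _ B => insert (pick B) B) n
  have hA : ∀ n, A (n + 1) = insert (pick (A n)) (A n) := fun n => rfl
  have hAmono : Monotone A := monotone_nat_of_le_succ fun n => by
    rw [hA]; exact Finset.subset_insert _ _
  refine ⟨fun n => pick (A n), fun s hs => ?_⟩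
  by_contra! hcon
  let x : ℕ → V := fun m => pick (A (Nat.nth (· ∈ s) m))
  refine htail ⟨x, fun k => e ((Finset.range k).image x), fun m k => ?_⟩
  have hnth : StrictMono (Nat.nth (· ∈ s)) := Nat.nth_strictMono hs
  constructor
  · intro h
    by_contra! hmk
    refine he _ ?_ _ (Finset.mem_image_of_mem x (Finset.mem_range.2 hmk)) h
    obtain ⟨i, hi, hir⟩ := hcon ((Finset.range k).image (Nat.nth (· ∈ s))) (by
      intro n hn
      simp only [Finset.coe_image, Set.mem_image] at hn
      obtain ⟨m, -, rfl⟩ := hn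
      exact Nat.nth_mem_of_infinite hs m)
    refine ⟨i, hi, fun w hw => ?_⟩
    obtain ⟨m, hm, rfl⟩ := Finset.mem_image.1 hw
    exact hir _ (Finset.mem_image_of_mem _ hm)
  · intro hkm
    refine hpick _ _ fun w hw => ?_
    obtain ⟨l, hl, rfl⟩ := Finset.mem_image.1 hw
    have hlm : Nat.nth (· ∈ s) l + 1 ≤ Nat.nth (· ∈ s) m :=
      hnth ((Finset.mem_range.1 hl).trans_le hkm)
    refine hAmono hlm ?_
    rw [hA]
    exact Finset.mem_insert_self _ _

/-- In a tail-free incidence relation, a family `G` of edges with the finite intersection property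
has finitely supported probability measures on vertices giving mass almost one to all edges
of `G`. -/
theorem exists_convexHull_forall_lt {V I : Type*} (r : V → I → Prop)
    (htail : ¬ ∃ (v : ℕ → V) (e : ℕ → I), ∀ m k, r (v m) (e k) ↔ k ≤ m)
    {G : Set I} (hG : G.Nonempty) (hfip : ∀ F : Finset I, ↑F ⊆ G → ∃ v, ∀ i ∈ F, r v i)
    {ε : ℝ} (hε : 0 < ε) :
    ∃ φ ∈ convexHull ℝ (Set.range fun (v : V) (i : I) => if r v i then (1 : ℝ) else 0),
      ∀ i ∈ G, 1 - ε < φ i := by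
  obtain ⟨v, hv⟩ := exists_seq_forall_infinite r htail hG hfip
  by_contra! hcon
  obtain ⟨U, hU⟩ := exists_frequently_le_of_convexHull
    (fun n => ultrafilterIndicator {i : G | ¬ r (v n) i}) 1 (fun n U => by
      simp only [ultrafilterIndicator_apply]
      split_ifs <;> simp) (half_lt_self hε) (by
    have hsub : convexHull ℝ (Set.range fun n => ultrafilterIndicator {i : G | ¬ r (v n) i}) ⊆
        {g | ∃ φ ∈ convexHull ℝ (Set.range fun (v : V) (i : I) => if r v i then (1 : ℝ) else 0),
          ∀ i : G, g (pure i) = 1 - φ i} := by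
      refine convexHull_min ?_ ?_
      · rintro _ ⟨n, rfl⟩
        refine ⟨_, subset_convexHull ℝ _ ⟨v n, rfl⟩, fun i => ?_⟩
        simp only [ultrafilterIndicator_apply, Ultrafilter.mem_pure, Set.mem_ofPred_eq]
        split_ifs <;> simp_all
      · rintro g ⟨φ, hφ, hg⟩ g' ⟨φ', hφ', hg'⟩ a b ha hb hab
        refine ⟨_, (convex_convexHull ℝ _) hφ hφ' ha hb hab, fun i => ?_⟩
        simp only [ContinuousMap.add_apply, ContinuousMap.smul_apply, smul_eq_mul, hg, hg',
          Pi.add_apply, Pi.smul_apply]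
        linear_combination hab
    intro g hg
    obtain ⟨φ, hφ, hgφ⟩ := hsub hg
    obtain ⟨i, hi, hle⟩ := hcon φ hφ
    exact ⟨pure ⟨i, hi⟩, by rw [hgφ]; dsimp only; linarith⟩)
  obtain ⟨t, ht, htG⟩ := hv {n | {i : G | ¬ r (v n) i} ∈ U} (by
    rw [← Nat.frequently_atTop_iff_infinite]
    refine hU.mono fun n hn => ?_
    by_contra hnot
    rw [ultrafilterIndicator_apply, if_neg hnot] at hn
    linarith)
  have hmem : (⋂ n ∈ t, {i : G | ¬ r (v n) i}) ∈ U :=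
    (Filter.biInter_finset_mem t).2 fun n hn => ht hn
  obtain ⟨i, hi⟩ := U.nonempty_of_mem hmem
  obtain ⟨n, hn, hr⟩ := htG i i.2
  simp only [Set.mem_iInter] at hi
  exact hi n hn hr

/-- A sequence of finitely supported probability measures on edges all of whose convex
combinations have a heavy vertex, while each vertex is eventually light, forces a tail. -/
theorem exists_tail_of_eventually_le {Z I : Type*} (r : Z → I → Prop) (q : ℕ → I →₀ ℝ)
    (hq0 : ∀ n i, 0 ≤ q n i) (hq1 : ∀ n, Finsupp.linearCombination ℝ (fun _ => (1 : ℝ)) (q n) = 1)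
    {c c' : ℝ} (hc' : 0 ≤ c') (hc : c' < c)
    (heavy : ∀ p ∈ convexHull ℝ (Set.range q),
      ∃ z, c ≤ Finsupp.linearCombination ℝ (fun i => if r z i then (1 : ℝ) else 0) p)
    (light : ∀ z, ∀ᶠ n in atTop,
      Finsupp.linearCombination ℝ (fun i => if r z i then (1 : ℝ) else 0) (q n) ≤ c') :
    ∃ (z : ℕ → Z) (e : ℕ → I), ∀ m k, r (z m) (e k) ↔ k ≤ m := by
  by_contra htail
  obtain ⟨d, hd', hd⟩ := exists_between hc
  let L : (I →₀ ℝ) →ₗ[ℝ] C(Ultrafilter Z, ℝ) :=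
    Finsupp.linearCombination ℝ fun i => ultrafilterIndicator {z | r z i}
  have hL : ∀ p U, L p U =
      Finsupp.linearCombination ℝ (fun i => if {z | r z i} ∈ U then (1 : ℝ) else 0) p := by
    intro p U
    simp only [L, Finsupp.linearCombination_apply, Finsupp.sum, ContinuousMap.sum_apply,
      ContinuousMap.smul_apply, ultrafilterIndicator_apply]
  obtain ⟨U, hU⟩ := exists_frequently_le_of_convexHull (fun n => L (q n)) 1 (fun n U => by
      rw [hL, abs_le]
      constructor
      · have := linearCombination_mono (hq0 n) (φ := fun _ => 0)
          (ψ := fun i => if {z | r z i} ∈ U then (1 : ℝ) else 0) (fun i => by split_ifs <;> simp)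
        simp only [Finsupp.linearCombination_apply, Finsupp.sum, smul_zero,
          Finset.sum_const_zero] at this ⊢
        linarith
      · exact (linearCombination_mono (hq0 n) (ψ := fun _ => 1)
          fun i => by split_ifs <;> simp).trans_eq (hq1 n)) hd (by
    intro g hg
    have hr : (Set.range fun n => L (q n)) = L '' Set.range q := by
      rw [← Set.range_comp]; rfl
    rw [hr, ← L.image_convexHull] at hg
    obtain ⟨p, hp, rfl⟩ := hg
    obtain ⟨z, hz⟩ := heavy p hp
    refine ⟨pure z, ?_⟩
    rw [hL]
    simpa only [Ultrafilter.mem_pure, Set.mem_ofPred_eq] using hz)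
  let G : Set I := {i | {z | r z i} ∈ U}
  have hdpos : 0 < d := hc'.trans_lt hd'
  have hG : G.Nonempty := by
    obtain ⟨n, hn⟩ := hU.exists
    by_contra! hempty
    rw [hL] at hn
    have : ∀ i, ¬ ({z | r z i} ∈ U) := fun i hi => by
      have : i ∈ G := hi
      simp [hempty] at this
    simp only [this, if_false, Finsupp.linearCombination_apply, Finsupp.sum, smul_zero,
      Finset.sum_const_zero] at hn
    linarith
  have hfip : ∀ F : Finset I, ↑F ⊆ G → ∃ z, ∀ i ∈ F, r z i := by
    intro F hF
    have hmem : (⋂ i ∈ F, {z | r z i}) ∈ U :=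
      (Filter.biInter_finset_mem F).2 fun i hi => hF hi
    obtain ⟨z, hz⟩ := U.nonempty_of_mem hmem
    exact ⟨z, fun i hi => by simpa using Set.mem_iInter₂.1 hz i hi⟩
  obtain ⟨ε, hε, hεd⟩ : ∃ ε : ℝ, 0 < ε ∧ c' < (1 - ε) * d := by
    refine ⟨(d - c') / (2 * d), by apply div_pos <;> linarith, ?_⟩
    have : (d - c') / (2 * d) * d = (d - c') / 2 := by field_simp
    linarith
  obtain ⟨φ, hφ, hφG⟩ := exists_convexHull_forall_lt r htail hG hfip hε
  have hsub : convexHull ℝ (Set.range fun (z : Z) (i : I) => if r z i then (1 : ℝ) else 0) ⊆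
      {φ | (∀ i, 0 ≤ φ i) ∧ ∀ᶠ n in atTop, Finsupp.linearCombination ℝ φ (q n) ≤ c'} := by
    refine convexHull_min ?_ ?_
    · rintro _ ⟨z, rfl⟩
      exact ⟨fun i => by dsimp only; split_ifs <;> simp, light z⟩
    · rintro φ ⟨hφ, hφ'⟩ ψ ⟨hψ, hψ'⟩ a b ha hb hab
      refine ⟨fun i => add_nonneg (mul_nonneg ha (hφ i)) (mul_nonneg hb (hψ i)), ?_⟩
      filter_upwards [hφ', hψ'] with n h1 h2
      have : Finsupp.linearCombination ℝ (a • φ + b • ψ) (q n) =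
          a * Finsupp.linearCombination ℝ φ (q n) + b * Finsupp.linearCombination ℝ ψ (q n) := by
        simp only [Finsupp.linearCombination_apply, Finsupp.sum, Finset.mul_sum,
          ← Finset.sum_add_distrib, Pi.add_apply, Pi.smul_apply, smul_eq_mul]
        exact Finset.sum_congr rfl fun i _ => by ring
      rw [this]
      calc _ ≤ a * c' + b * c' := by gcongr
        _ = c' := by rw [← add_mul, hab, one_mul]
  obtain ⟨hφ0, hφe⟩ := hsub hφ
  obtain ⟨n, hn, hn'⟩ := (hU.and_eventually hφe).exists
  rw [hL] at hn
  have h1ε : 0 ≤ 1 - ε := by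
    by_contra! h
    nlinarith
  have hlow := linearCombination_mono (hq0 n)
    (φ := (1 - ε) • fun i => if {z | r z i} ∈ U then (1 : ℝ) else 0) (ψ := φ) (fun i => by
      by_cases hi : {z | r z i} ∈ U
      · simpa [hi] using (hφG i hi).le
      · simpa [hi] using hφ0 i)
  have hsm : Finsupp.linearCombination ℝ
      ((1 - ε) • fun i => if {z | r z i} ∈ U then (1 : ℝ) else 0) (q n) =
      (1 - ε) * Finsupp.linearCombination ℝ (fun i => if {z | r z i} ∈ U then (1 : ℝ) else 0)
        (q n) := by
    simp only [Finsupp.linearCombination_apply, Finsupp.sum, Finset.mul_sum, Pi.smul_apply,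
      smul_eq_mul]
    exact Finset.sum_congr rfl fun i _ => by ring
  rw [hsm] at hlow
  linarith [mul_le_mul_of_nonneg_left hn h1ε]

theorem exists_finset_forall_exists_iff {V I : Type*} (r : V → I → Prop) (F : Finset I) :
    ∃ R : Finset V, ∀ v, ∃ v' ∈ R, ∀ i ∈ F, r v i ↔ r v' i := by
  let f : V → Finset I := fun v => F.filter (r v)
  have hfin : (Set.range f).Finite := (F.powerset.finite_toSet).subset (by
    rintro _ ⟨v, rfl⟩
    simpa only [f, Finset.coe_powerset, Set.mem_preimage, Set.mem_powerset_iff,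
      Finset.coe_subset] using Finset.filter_subset _ _)
  have := hfin.to_subtype
  refine ⟨(Set.finite_range (Set.rangeSplitting f)).toFinset, fun v =>
    ⟨Set.rangeSplitting f ⟨f v, v, rfl⟩, by simp, fun i hi => ?_⟩⟩
  have h := Set.apply_rangeSplitting f ⟨f v, v, rfl⟩
  have hi' := congrArg (i ∈ ·) h
  simp only [f, Finset.mem_filter, hi, true_and] at hi'
  exact (iff_of_eq hi').symm

/-- In a tail-free incidence relation, if every finitely supported probability measure on edges has
a vertex of weight at least `c`, then for `c' < c` some finite set of vertices contains, for each
such measure, a vertex of weight greater than `c'`. -/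
theorem exists_finset_forall_exists_lt {V I : Type*} (r : V → I → Prop)
    (htail : ¬ ∃ (v : ℕ → V) (e : ℕ → I), ∀ m k, r (v m) (e k) ↔ k ≤ m)
    {c c' : ℝ} (hc' : 0 ≤ c') (hc : c' < c)
    (heavy : ∀ p : I →₀ ℝ, (∀ i, 0 ≤ p i) →
      Finsupp.linearCombination ℝ (fun _ => (1 : ℝ)) p = 1 →
      ∃ v, c ≤ Finsupp.linearCombination ℝ (fun i => if r v i then (1 : ℝ) else 0) p) :
    ∃ S : Finset V, ∀ p : I →₀ ℝ, (∀ i, 0 ≤ p i) →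
      Finsupp.linearCombination ℝ (fun _ => (1 : ℝ)) p = 1 →
      ∃ v ∈ S, c' < Finsupp.linearCombination ℝ (fun i => if r v i then (1 : ℝ) else 0) p := by
  by_contra! hcon
  choose q hq0 hq1 hq using hcon
  choose R hR using exists_finset_forall_exists_iff r
  let A : ℕ → Finset V × Finset I := fun n =>
    Nat.rec (∅, ∅) (fun _ B => (B.1 ∪ R (B.2 ∪ (q B.1).support), B.2 ∪ (q B.1).support)) n
  have hA1 : ∀ n, (A (n + 1)).1 = (A n).1 ∪ R (A (n + 1)).2 := fun n => rfl
  have hA2 : ∀ n, (A (n + 1)).2 = (A n).2 ∪ (q (A n).1).support := fun n => rfl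
  have hm1 : Monotone fun n => (A n).1 := monotone_nat_of_le_succ fun n => by
    rw [hA1]; exact Finset.subset_union_left
  have hm2 : Monotone fun n => (A n).2 := monotone_nat_of_le_succ fun n => by
    rw [hA2]; exact Finset.subset_union_left
  obtain ⟨z, e, hze⟩ := exists_tail_of_eventually_le
    (fun (z : {v // ∃ n, v ∈ (A n).1}) i => r z i) (fun n => q (A n).1) (fun n => hq0 _)
    (fun n => hq1 _) hc' hc (by
      intro p hp
      have hsub : convexHull ℝ (Set.range fun n => q (A n).1) ⊆
          {p | (∀ i, 0 ≤ p i) ∧ Finsupp.linearCombination ℝ (fun _ => (1 : ℝ)) p = 1 ∧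
            ∃ n, p.support ⊆ (A (n + 1)).2} := by
        refine convexHull_min ?_ ?_
        · rintro _ ⟨n, rfl⟩
          exact ⟨hq0 _, hq1 _, n, by rw [hA2]; exact Finset.subset_union_right⟩
        · rintro p ⟨hp0, hp1, n, hn⟩ p' ⟨hp0', hp1', n', hn'⟩ a b ha hb hab
          refine ⟨fun i => ?_, ?_, max n n', ?_⟩
          · simpa using add_nonneg (mul_nonneg ha (hp0 i)) (mul_nonneg hb (hp0' i))
          · simpa [map_add, map_smul, hp1, hp1'] using hab
          · refine Finsupp.support_add.trans (Finset.union_subset ?_ ?_)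
            · exact Finsupp.support_smul.trans
                (hn.trans (hm2 (Nat.succ_le_succ (le_max_left _ _))))
            · exact Finsupp.support_smul.trans
                (hn'.trans (hm2 (Nat.succ_le_succ (le_max_right _ _))))
      obtain ⟨hp0, hp1, n, hn⟩ := hsub hp
      obtain ⟨v, hv⟩ := heavy p hp0 hp1
      obtain ⟨v', hv', hvv'⟩ := hR (A (n + 1)).2 v
      refine ⟨⟨v', n + 1, by rw [hA1]; exact Finset.mem_union_right _ hv'⟩, hv.trans_eq ?_⟩
      simp only [Finsupp.linearCombination_apply, Finsupp.sum]
      exact Finset.sum_congr rfl fun i hi => by simp only [hvv' i (hn hi)])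
    (by
      rintro ⟨v, n, hn⟩
      filter_upwards [eventually_ge_atTop n] with m hm
      exact hq _ v (hm1 hm hn))
  exact htail ⟨fun m => z m, e, hze⟩

/-- The finite minimax theorem, for a finite set `S` of vertices: if each finitely supported
probability measure on edges has a vertex of weight greater than `c` in `S`, then a probability
measure on `S` gives weight at least `c` to every edge. -/
theorem exists_weight_of_forall_exists_lt {V I : Type*} [Nonempty I] (r : V → I → Prop) {c : ℝ}
    (S : Finset V)
    (hS : ∀ p : I →₀ ℝ, (∀ i, 0 ≤ p i) →
      Finsupp.linearCombination ℝ (fun _ => (1 : ℝ)) p = 1 →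
      ∃ v ∈ S, c < Finsupp.linearCombination ℝ (fun i => if r v i then (1 : ℝ) else 0) p) :
    ∃ g : V → ℝ, (∀ v, 0 ≤ g v) ∧ ∑ v ∈ S, g v = 1 ∧
      ∀ i, c ≤ ∑ v ∈ S, if r v i then g v else 0 := by
  let : TopologicalSpace S := ⊥
  have : DiscreteTopology S := ⟨rfl⟩
  borelize ↥S
  let w : (I →₀ ℝ) → V → ℝ := fun p v =>
    Finsupp.linearCombination ℝ (fun i => if r v i then (1 : ℝ) else 0) p
  let C : Set C(S, ℝ) := {h | ∃ p : I →₀ ℝ, (∀ i, 0 ≤ p i) ∧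
    Finsupp.linearCombination ℝ (fun _ => (1 : ℝ)) p = 1 ∧ ∀ v : S, h v = w p v - c}
  have hsingle : ∀ i, (⟨fun v => (if r v i then 1 else 0) - c, continuous_of_discreteTopology⟩ :
      C(S, ℝ)) ∈ C := fun i => by
    refine ⟨Finsupp.single i 1, fun j => ?_, by simp, fun v => by simp [w]⟩
    exact Finsupp.single_nonneg.2 zero_le_one j
  have hC : Convex ℝ C := by
    rintro h ⟨p, hp0, hp1, hp⟩ h' ⟨p', hp0', hp1', hp'⟩ a b ha hb hab
    refine ⟨a • p + b • p', fun i => ?_, ?_, fun v => ?_⟩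
    · simpa using add_nonneg (mul_nonneg ha (hp0 i)) (mul_nonneg hb (hp0' i))
    · simpa [map_add, map_smul, hp1, hp1'] using hab
    · simp only [w, map_add, map_smul, ContinuousMap.add_apply, ContinuousMap.smul_apply, hp, hp',
        smul_eq_mul]
      linear_combination (-c) * hab
  obtain ⟨i₀⟩ := ‹Nonempty I›
  obtain ⟨μ, _, hμ0, hμ⟩ := exists_measure_forall_integral_nonneg hC ⟨_, hsingle i₀⟩ (by
    rintro h ⟨p, hp0, hp1, hp⟩
    obtain ⟨v, hv, hlt⟩ := hS p hp0 hp1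
    exact ⟨⟨v, hv⟩, by rw [hp]; exact (sub_pos.2 hlt).le⟩)
  have hmass : 0 < μ.real Set.univ := by
    rw [measureReal_def, ENNReal.toReal_pos_iff]
    exact ⟨by simpa [pos_iff_ne_zero] using hμ0, measure_lt_top _ _⟩
  have hint : ∀ h : S → ℝ, ∫ v, h v ∂μ = ∑ v, μ.real {v} * h v := fun h => by
    rw [integral_fintype (Integrable.of_finite)]
    rfl
  have htot : ∑ v : S, μ.real {v} = μ.real Set.univ := by simp
  refine ⟨fun v => if h : v ∈ S then μ.real {⟨v, h⟩} / μ.real Set.univ else 0, fun v => ?_, ?_,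
    fun i => ?_⟩
  · dsimp only
    split_ifs
    · positivity
    · exact le_rfl
  · rw [← Finset.sum_coe_sort]
    simp only [Finset.coe_mem, dite_true, Subtype.coe_eta]
    rw [← Finset.sum_div, htot, div_self hmass.ne']
  · rw [← Finset.sum_coe_sort]
    simp only [Finset.coe_mem, dite_true, Subtype.coe_eta]
    have h := hμ _ (hsingle i)
    simp only [ContinuousMap.coe_mk] at h
    rw [hint] at h
    simp only [mul_sub, Finset.sum_sub_distrib, ← Finset.sum_mul, htot, mul_ite, mul_one,
      mul_zero] at h
    have h2 : ∑ v : S, (if r v i then μ.real {v} / μ.real Set.univ else 0) =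
        (∑ v : S, if r v i then μ.real {v} else 0) / μ.real Set.univ := by
      rw [Finset.sum_div]
      exact Finset.sum_congr rfl fun v _ => by split_ifs <;> simp
    rw [h2, le_div_iff₀ hmass]
    linarith

theorem nuStar_le_tauStar {V : Type*} (E : Set (Set V)) : nuStar E ≤ tauStar E := by
  refine sSup_le ?_
  rintro _ ⟨f, hf, rfl⟩
  refine le_sInf ?_
  rintro _ ⟨g, hg, rfl⟩
  calc ∑' e : E, (f e : ℝ≥0∞)
      ≤ ∑' e : E, (f e : ℝ≥0∞) * ∑' v : V, (e : Set V).indicator (fun v => (g v : ℝ≥0∞)) v := by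
        refine ENNReal.tsum_le_tsum fun e => ?_
        rw [← tsum_subtype]
        exact le_mul_of_one_le_right' (hg e e.2)
    _ = ∑' v : V, (g v : ℝ≥0∞) * ∑' e : E, if v ∈ (e : Set V) then (f e : ℝ≥0∞) else 0 := by
        simp only [← ENNReal.tsum_mul_left]
        rw [ENNReal.tsum_comm]
        refine tsum_congr fun v => tsum_congr fun e => ?_
        by_cases h : v ∈ (e : Set V) <;> simp [h, mul_comm]
    _ ≤ ∑' v : V, (g v : ℝ≥0∞) := ENNReal.tsum_le_tsum fun v => mul_le_of_le_one_right' (hf v)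

theorem exists_le_linearCombination_of_nuStar_lt {V : Type*} {E : Set (Set V)} {t : ℝ≥0}
    (ht : nuStar E < t) (p : E →₀ ℝ) (hp0 : ∀ e, 0 ≤ p e)
    (hp1 : Finsupp.linearCombination ℝ (fun _ => (1 : ℝ)) p = 1) :
    ∃ v : V, (t : ℝ)⁻¹ ≤
      Finsupp.linearCombination ℝ (fun e : E => if v ∈ (e : Set V) then (1 : ℝ) else 0) p := by
  by_contra! hcon
  have ht0 : 0 < t := by exact_mod_cast zero_le.trans_lt ht
  have hsum : ∀ φ : E → ℝ, (∀ e, φ e = 0 ∨ φ e = 1) →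
      ∑' e : E, (if φ e = 1 then ((t * (p e).toNNReal : ℝ≥0) : ℝ≥0∞) else 0) =
        ENNReal.ofReal (t * Finsupp.linearCombination ℝ φ p) := by
    intro φ hφ
    rw [tsum_eq_sum (s := p.support) (fun e he => by
      simp [Finsupp.notMem_support_iff.1 he])]
    rw [Finsupp.linearCombination_apply, Finsupp.sum, Finset.mul_sum, ENNReal.ofReal_sum_of_nonneg]
    · refine Finset.sum_congr rfl fun e _ => ?_
      rcases hφ e with h | h
      · simp [h]
      · simp [h, ENNReal.ofReal, Real.toNNReal_mul]
    · intro e _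
      have := hp0 e
      rcases hφ e with h | h <;> simp only [h, smul_eq_mul] <;> positivity
  refine ht.not_ge (le_sSup ⟨fun e => t * (p e).toNNReal, fun v => ?_, ?_⟩)
  · have h := hsum (fun e : E => if v ∈ (e : Set V) then (1 : ℝ) else 0)
      (fun e => by split_ifs <;> simp)
    simp only [ite_eq_left_iff, zero_ne_one, imp_false, not_not] at h
    rw [h, ← ENNReal.ofReal_one]
    refine ENNReal.ofReal_le_ofReal ?_
    have ht0' : (0 : ℝ) < t := ht0
    have := mul_le_mul_of_nonneg_left (hcon v).le ht0'.le
    rwa [mul_inv_cancel₀ ht0'.ne'] at this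
  · have h := hsum (fun _ => 1) (fun e => Or.inr rfl)
    simp only [if_true] at h
    rw [h, hp1]
    simp

theorem tauStar_le_of_weight {V : Type*} {E : Set (Set V)} {t : ℝ≥0} (ht : 0 < t) (S : Finset V)
    (g : V → ℝ) (hg0 : ∀ v, 0 ≤ g v) (hg1 : ∑ v ∈ S, g v = 1)
    (hg : ∀ e : E, (t : ℝ)⁻¹ ≤ ∑ v ∈ S, if v ∈ (e : Set V) then g v else 0) :
    tauStar E ≤ t := by
  have ht' : (0 : ℝ) < t := ht
  refine sInf_le ⟨fun v => if v ∈ S then t * (g v).toNNReal else 0, fun e he => ?_, ?_⟩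
  · rw [tsum_subtype e fun v => ((if v ∈ S then t * (g v).toNNReal else 0 : ℝ≥0) : ℝ≥0∞)]
    refine le_trans ?_ (ENNReal.sum_le_tsum S)
    have h := mul_le_mul_of_nonneg_left (hg ⟨e, he⟩) ht'.le
    rw [mul_inv_cancel₀ ht'.ne', Finset.mul_sum] at h
    rw [← ENNReal.ofReal_one]
    refine (ENNReal.ofReal_le_ofReal h).trans ?_
    rw [ENNReal.ofReal_sum_of_nonneg fun v _ => by
      have := hg0 v
      split_ifs <;> positivity]
    refine Finset.sum_le_sum fun v hv => ?_
    by_cases hve : v ∈ e <;> simp [hve, hv, ENNReal.ofReal, Real.toNNReal_mul]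
  · rw [tsum_eq_sum (s := S) (fun v hv => by simp [hv])]
    rw [Finset.sum_congr rfl (g := fun v => (t : ℝ≥0∞) * ENNReal.ofReal (g v)) fun v hv => by
      simp [hv, ENNReal.ofReal]]
    rw [← Finset.mul_sum, ← ENNReal.ofReal_sum_of_nonneg fun v _ => hg0 v, hg1]
    simp

/-- Duality holds in a hypergraph without tails. -/
theorem nuStar_eq_tauStar_of_no_tail {V : Type*} {E : Set (Set V)} (hE : E.Nonempty)
    (htail : ¬ ∃ (v : ℕ → V) (e : ℕ → E), ∀ i j, v i ∈ (e j : Set V) ↔ j ≤ i) :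
    nuStar E = tauStar E := by
  refine le_antisymm (nuStar_le_tauStar E) ?_
  by_contra! hlt
  obtain ⟨t₁, h₁, h₁'⟩ := ENNReal.lt_iff_exists_nnreal_btwn.1 hlt
  obtain ⟨t₂, h₂, h₂'⟩ := ENNReal.lt_iff_exists_nnreal_btwn.1 h₁'
  have ht₁ : 0 < t₁ := by exact_mod_cast zero_le.trans_lt h₁
  have ht : t₁ < t₂ := by exact_mod_cast h₂
  have := hE.to_subtype
  obtain ⟨S, hS⟩ := exists_finset_forall_exists_lt (fun (v : V) (e : E) => v ∈ (e : Set V)) htail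
    (c := (t₁ : ℝ)⁻¹) (c' := (t₂ : ℝ)⁻¹) (by positivity)
    (inv_strictAnti₀ (by exact_mod_cast ht₁) (by exact_mod_cast ht))
    (exists_le_linearCombination_of_nuStar_lt h₁)
  obtain ⟨g, hg0, hg1, hg⟩ := exists_weight_of_forall_exists_lt _ S hS
  exact h₂'.not_ge (tauStar_le_of_weight (ht₁.trans ht) S g hg0 hg1 hg)

theorem nuStar_le_one_of_forall_finset {V : Type*} {E : Set (Set V)}
    (h : ∀ F : Finset E, ∃ v, ∀ e ∈ F, v ∈ (e : Set V)) : nuStar E ≤ 1 := by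
  refine sSup_le ?_
  rintro _ ⟨f, hf, rfl⟩
  rw [ENNReal.tsum_eq_iSup_sum]
  refine iSup_le fun F => ?_
  obtain ⟨v, hv⟩ := h F
  calc ∑ e ∈ F, (f e : ℝ≥0∞) = ∑ e ∈ F, if v ∈ (e : Set V) then (f e : ℝ≥0∞) else 0 :=
        Finset.sum_congr rfl fun e he => by rw [if_pos (hv e he)]
    _ ≤ ∑' e : E, if v ∈ (e : Set V) then (f e : ℝ≥0∞) else 0 := ENNReal.sum_le_tsum F
    _ ≤ 1 := hf v

theorem tauStar_eq_top_of_forall_finset {V : Type*} {E : Set (Set V)}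
    (h : ∀ F : Finset V, ∃ e ∈ E, ∀ v ∈ F, v ∉ e) : tauStar E = ⊤ := by
  refine sInf_eq_top.2 ?_
  rintro _ ⟨g, hg, rfl⟩
  by_contra hne
  obtain ⟨F, hF⟩ := ((ENNReal.tendsto_tsum_compl_atTop_zero hne).eventually_lt_const
    one_pos).exists
  obtain ⟨e, he, heF⟩ := h F
  refine (hg e he).not_gt (lt_of_le_of_lt ?_ hF)
  exact ENNReal.tsum_mono_subtype (fun v => (g v : ℝ≥0∞)) (s := e) (t := {v | v ∉ F})
    fun v hve hvF => heF v hvF hve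

/-- Theorem 4.7: every partial sub-hypergraph of `H = (V, E)` satisfies the weak
duality property `ν* = τ*` if and only if `H` has no partial sub-hypergraph isomorphic
to the tail hypergraph, i.e. iff there are no injective sequences of vertices `v i`
and edges `e j` with `v i ∈ e j ↔ j ≤ i`. -/
theorem weak_duality_hereditary_iff_no_tail
    {V : Type*} [Nonempty V] (E : Set (Set V)) (hE : E.Nonempty) :
    (∀ (V' : Set V) (E₀ : Set (Set V)), V'.Nonempty → E₀.Nonempty → E₀ ⊆ E →
        nuStar (subEdges V' E₀) = tauStar (subEdges V' E₀)) ↔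
    ¬ ∃ (v : ℕ → V) (e : ℕ → Set V), Function.Injective v ∧ Function.Injective e ∧
        (∀ j, e j ∈ E) ∧ ∀ i j, v i ∈ e j ↔ j ≤ i := by
  constructor
  · rintro hdual ⟨v, e, -, -, heE, hve⟩
    have h := hdual (Set.range v) (Set.range e) (Set.range_nonempty v) (Set.range_nonempty e)
      (by rintro _ ⟨j, rfl⟩; exact heE j)
    have hν : nuStar (subEdges (Set.range v) (Set.range e)) ≤ 1 := by
      refine nuStar_le_one_of_forall_finset fun F => ?_
      have hidx : ∀ A : subEdges (Set.range v) (Set.range e),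
          ∃ j, (A : Set (Set.range v)) = Subtype.val ⁻¹' e j := by
        rintro ⟨_, _, ⟨j, rfl⟩, rfl⟩
        exact ⟨j, rfl⟩
      choose idx hidx using hidx
      refine ⟨⟨v (F.sup idx), _, rfl⟩, fun A hA => ?_⟩
      rw [hidx A]
      exact (hve _ _).2 (Finset.le_sup hA)
    have hτ : tauStar (subEdges (Set.range v) (Set.range e)) = ⊤ := by
      refine tauStar_eq_top_of_forall_finset fun F => ?_
      choose idx hidx using fun x : Set.range v => x.2
      refine ⟨_, ⟨e (F.sup idx + 1), ⟨_, rfl⟩, rfl⟩, fun x hx hxe => ?_⟩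
      have hxe' : v (idx x) ∈ e (F.sup idx + 1) := by rw [hidx]; exact hxe
      have h1 := (hve _ _).1 hxe'
      have h2 := Finset.le_sup (f := idx) hx
      omega
    rw [h, hτ] at hν
    exact absurd hν (by simp)
  · intro htail V' E₀ _ hE₀ hsub
    refine nuStar_eq_tauStar_of_no_tail ?_ ?_
    · obtain ⟨e, he⟩ := hE₀
      exact ⟨_, e, he, rfl⟩
    · rintro ⟨v, e, hve⟩
      choose e' he' hee' using fun j => (e j).2
      have hve' : ∀ i j, (v i : V) ∈ e' j ↔ j ≤ i := fun i j => by
        rw [← hve i j, hee' j]; rfl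
      refine htail ⟨fun i => v i, e', fun i j hij => ?_, fun i j hij => ?_,
        fun j => hsub (he' j), hve'⟩
      · have h1 := (hve' j i).1 (by
          have := (hve' i i).2 le_rfl
          simpa only [hij] using this)
        have h2 := (hve' i j).1 (by
          have := (hve' j j).2 le_rfl
          simpa only [hij] using this)
        exact le_antisymm h1 h2
      · have h1 := (hve' i j).1 (by rw [← hij]; exact (hve' i i).2 le_rfl)
        have h2 := (hve' j i).1 (by rw [hij]; exact (hve' j j).2 le_rfl)
        exact le_antisymm h2 h1
end
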